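/- Let d ≥ 1, let L ≥ 1 be an integer, and let i₁, i₂ ∈ ℤ^d with Λ := ‖i₁ − i₂‖_∞ ≥ 8L. Let F = B(i₁, Λ−3L) ∩ B(i₂, Λ−3L) ∩ sbox({i₁,i₂}). Then F is nonempty, and F intersects both B(i₁, 6L) and B(i₂, 6L). -/

import Mathlib

/-- Points of `ℤ^d`. -/
abbrev Pt (d : ℕ) := Fin d → ℤ

namespace RI

variable {d : ℕ}

/-- `l¹` distance between two points (ℕ-valued). -/
def n1 (x y : Pt d) : ℕ := ∑ j, (x j - y j).natAbs

/-- `l∞` distance between two points (ℕ-valued). -/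
def ninf (x y : Pt d) : ℕ := Finset.univ.sup fun j => (x j - y j).natAbs

/-- nearest-neighbor adjacency: `‖x - y‖₁ = 1` -/
def adj (x y : Pt d) : Prop := n1 x y = 1

/-- `*`-adjacency: `‖x - y‖_∞ = 1` -/
def adjStar (x y : Pt d) : Prop := ninf x y = 1

/-- `τ` is a nearest-neighbor path of length `N`. -/
def IsPath (τ : ℕ → Pt d) (N : ℕ) : Prop := ∀ l < N, adj (τ l) (τ (l + 1))

/-- the range of a path of length `N` -/
def pathRange (τ : ℕ → Pt d) (N : ℕ) : Set (Pt d) := τ '' {l | l ≤ N}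

/-- `x` and `y` are joined by a nearest-neighbor path all of whose points lie in `U`. -/
def ConnIn (U : Set (Pt d)) (x y : Pt d) : Prop :=
  ∃ τ N, IsPath τ N ∧ τ 0 = x ∧ τ N = y ∧ ∀ l ≤ N, τ l ∈ U

/-- a set is connected: any two of its points are joined by a path inside it -/
def ConnSet (A : Set (Pt d)) : Prop := ∀ x ∈ A, ∀ y ∈ A, ConnIn A x y

/-- the connected component of `U` containing `x` -/
def comp (U : Set (Pt d)) (x : Pt d) : Set (Pt d) := {y | ConnIn U x y}

/-- the (outer) boundary `∂K` -/
def bd (K : Set (Pt d)) : Set (Pt d) := {x | x ∉ K ∧ ∃ y ∈ K, adj x y}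

/-- the `*`-boundary `∂*K` -/
def bdStar (K : Set (Pt d)) : Set (Pt d) := {x | x ∉ K ∧ ∃ y ∈ K, adjStar x y}

/-- the interior boundary `∂_int K` -/
def intBd (K : Set (Pt d)) : Set (Pt d) := {x | x ∈ K ∧ ∃ y, y ∉ K ∧ adj x y}

/-- the `l∞` diameter of a set, valued in `ℕ∞` -/
noncomputable def diam (K : Set (Pt d)) : ℕ∞ := ⨆ x ∈ K, ⨆ y ∈ K, (ninf x y : ℕ∞)

/-- the `l¹` distance between `K` and `K'` exceeds `1` -/
def far1 (K K' : Set (Pt d)) : Prop := ∀ x ∈ K, ∀ y ∈ K', 1 < n1 x y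

/-- the `l∞` distance between `K` and `K'` exceeds `1` -/
def farInf (K K' : Set (Pt d)) : Prop := ∀ x ∈ K, ∀ y ∈ K', 1 < ninf x y

/-- `d_∞(K, K') ≤ r` -/
def dInfLE (K K' : Set (Pt d)) (r : ℕ) : Prop := ∃ x ∈ K, ∃ y ∈ K', ninf x y ≤ r

/-- `fill A`: the set of points every connected set around which inside `Aᶜ` is finite;
for `d ≥ 2` and finite `A` this is exactly the complement of the unique infinite
connected component of `Aᶜ`. -/
def fill (A : Set (Pt d)) : Set (Pt d) :=
  {z | ∀ S : Set (Pt d), z ∈ S → S ⊆ Aᶜ → ConnSet S → S.Finite}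

/-- `A₁` and `A₂` are separated by `𝒰` in `B`: `d(A₁,A₂) > 1` and every path in `B`
joining `∂A₁` to `∂A₂` meets `𝒰`. -/
def SeparatedBy (A₁ A₂ 𝒰 B : Set (Pt d)) : Prop :=
  far1 A₁ A₂ ∧
  ∀ τ N, IsPath τ N → (∀ l ≤ N, τ l ∈ B) → τ 0 ∈ bd A₁ → τ N ∈ bd A₂ →
    ∃ l ≤ N, τ l ∈ 𝒰

/-- the scales `L_κ = L₀ (80 L)^κ` -/
def Lscale (L L₀ κ : ℕ) : ℕ := L₀ * (80 * L) ^ κ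

/-- the box `C_{(κ,i)} = (i L_κ + [0, L_κ)^d) ∩ ℤ^d` -/
def boxC (L L₀ κ : ℕ) (i : Pt d) : Set (Pt d) :=
  {x | ∀ j, i j * (Lscale L L₀ κ : ℤ) ≤ x j ∧
    x j < i j * (Lscale L L₀ κ : ℤ) + (Lscale L L₀ κ : ℤ)}

/-- the neighborhood `C_{(κ,i)}^l = ⋃_{‖j‖_∞ < l} C_{(κ, i+j)}` -/
def boxCl (L L₀ κ : ℕ) (i : Pt d) (l : ℕ) : Set (Pt d) :=
  ⋃ j ∈ {j : Pt d | ∀ t, (j t).natAbs < l}, boxC L L₀ κ (i + j)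

/-- the separation event `χ_{(κ,i)}(𝒰) = 1`: there are connected sets
`A₁, A₂ ⊆ C_{(κ,i)}^2` of diameter at least `L_κ / 2` separated by `𝒰` in `C_{(κ,i)}^3` -/
def chi (L L₀ κ : ℕ) (i : Pt d) (𝒰 : Set (Pt d)) : Prop :=
  ∃ A₁ A₂ : Set (Pt d), A₁ ⊆ boxCl L L₀ κ i 2 ∧ A₂ ⊆ boxCl L L₀ κ i 2 ∧
    ConnSet A₁ ∧ ConnSet A₂ ∧
    (Lscale L L₀ κ : ℕ∞) ≤ 2 * diam A₁ ∧ (Lscale L L₀ κ : ℕ∞) ≤ 2 * diam A₂ ∧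
    SeparatedBy A₁ A₂ 𝒰 (boxCl L L₀ κ i 3)

/-- the centered boxes `C^l = [-(l-1)L₀, l L₀)^d ∩ ℤ^d` -/
def boxCen (L₀ l : ℕ) : Set (Pt d) :=
  {x | ∀ j, -(((l : ℤ) - 1) * (L₀ : ℤ)) ≤ x j ∧ x j < (l : ℤ) * (L₀ : ℤ)}

/-- the separation event `χ(𝒰) = 1` for the centered boxes -/
def chi0 (L₀ : ℕ) (𝒰 : Set (Pt d)) : Prop :=
  ∃ A₁ A₂ : Set (Pt d), A₁ ⊆ boxCen L₀ 2 ∧ A₂ ⊆ boxCen L₀ 2 ∧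
    ConnSet A₁ ∧ ConnSet A₂ ∧
    (L₀ : ℕ∞) ≤ 2 * diam A₁ ∧ (L₀ : ℕ∞) ≤ 2 * diam A₂ ∧
    SeparatedBy A₁ A₂ 𝒰 (boxCen L₀ 3)

/-- `A` is `h`-avoidable in `C`: every path in `C` with endpoints outside `A` can be
modified, within `l∞` distance `h` of its range and through `Range(τ) ∪ ∂*A`,
into a path with the same endpoints avoiding `A`. -/
def Avoidable (h : ℝ) (A C : Set (Pt d)) : Prop :=
  ∀ τ N, IsPath τ N → (∀ l ≤ N, τ l ∈ C) → τ 0 ∉ A → τ N ∉ A →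
    ∃ τ' N', IsPath τ' N' ∧ τ' 0 = τ 0 ∧ τ' N' = τ N ∧
      (∀ l ≤ N', τ' l ∉ A) ∧
      (∀ l ≤ N', (∃ k ≤ N, (ninf (τ' l) (τ k) : ℝ) ≤ h) ∧
        (τ' l ∈ pathRange τ N ∨ τ' l ∈ bdStar A))

/-- a doubly infinite transient nearest-neighbor trajectory -/
def IsTraj (w : ℤ → Pt d) : Prop :=
  (∀ l : ℤ, adj (w l) (w (l + 1))) ∧
  Filter.Tendsto (fun l : ℤ => n1 (w l) 0) Filter.cofinite Filter.atTop

/-- `k` is a cut-time of `w`: `d_∞({w(l) : l < k}, {w(l) : l > k}) > 1` -/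
def CutTime (w : ℤ → Pt d) (k : ℤ) : Prop :=
  ∀ l, l < k → ∀ l', k < l' → 1 < ninf (w l) (w l')

/-- the `j`-th sausage `𝒰_j = {w(l) : n_j < l < n_{j+1}}` -/
def sausage (w : ℤ → Pt d) (n : ℕ → ℤ) (j : ℕ) : Set (Pt d) :=
  w '' {l | n j < l ∧ l < n (j + 1)}

/-- boxes: products of integer intervals -/
def IsBox (B : Set (Pt d)) : Prop :=
  ∃ a b : Pt d, B = {x | ∀ j, a j ≤ x j ∧ x j ≤ b j}

/-- the smallest box containing `K` -/
def sbox (K : Set (Pt d)) : Set (Pt d) := ⋂₀ {B | IsBox B ∧ K ⊆ B}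

/-- the closed `l∞` ball `B(x, r)` -/
def ball (x : Pt d) (r : ℕ) : Set (Pt d) := {y | ninf x y ≤ r}

/-- a skeleton: a set of indices at the finest scale satisfying the Wiener-type
spacing conditions -/
def IsSkeleton (L L₀ : ℕ) (M : Finset (Pt d)) : Prop :=
  ∀ m₀ ∈ M,
    (∀ h : ℕ,
      {m : Pt d | m ∈ M ∧
        dInfLE (boxC L L₀ 0 m₀) (boxC L L₀ 0 m) (L * Lscale L L₀ (h + 1)) ∧
        ¬ dInfLE (boxC L L₀ 0 m₀) (boxC L L₀ 0 m) (L * Lscale L L₀ h)}.ncard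
        ≤ 2 ^ (h + 1)) ∧
    ∀ m ∈ M, m ≠ m₀ → ¬ dInfLE (boxC L L₀ 0 m₀) (boxC L L₀ 0 m) (L * Lscale L L₀ 0)

theorem ninf_le_iff {x y : Pt d} {r : ℕ} : ninf x y ≤ r ↔ ∀ j, (x j - y j).natAbs ≤ r := by
  simp [ninf]

theorem ninf_comm (x y : Pt d) : ninf x y = ninf y x := by
  exact Finset.sup_congr rfl fun j _ => by omega

/-- a point lying coordinatewise between `x` and `y` belongs to `sbox {x, y}` -/
theorem mem_sbox_pair {x y z : Pt d}
    (hz : ∀ j, min (x j) (y j) ≤ z j ∧ z j ≤ max (x j) (y j)) : z ∈ sbox {x, y} := by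
  rintro B ⟨⟨a, b, rfl⟩, hB⟩ j
  have hx := hB (Set.mem_insert x {y}) j
  have hy := hB (Set.mem_insert_of_mem x rfl) j
  exact ⟨(le_min hx.1 hy.1).trans (hz j).1, (hz j).2.trans (max_le hx.2 hy.2)⟩

/-- moving every coordinate of `x` towards `y` by at most `r` gives a point of `sbox {x, y}`
within distance `r` of `x` and `ninf x y - r` of `y` -/
theorem exists_mem_sbox_pair_near (x y : Pt d) (r : ℕ) :
    ∃ z ∈ sbox {x, y}, ninf x z ≤ r ∧ ninf y z ≤ ninf x y - r := by
  have h := ninf_le_iff.1 (le_refl (ninf x y))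
  refine ⟨fun j => max (x j - r) (min (x j + r) (y j)), mem_sbox_pair fun j => ?_,
    ninf_le_iff.2 fun j => ?_, ninf_le_iff.2 fun j => ?_⟩
  all_goals
    have := h j
    omega

/-- for `Λ = ‖i₁ - i₂‖_∞ ≥ 8L`, the set
`F = B(i₁, Λ-3L) ∩ B(i₂, Λ-3L) ∩ sbox({i₁,i₂})` is nonempty and intersects both
`B(i₁, 6L)` and `B(i₂, 6L)`. -/
theorem statement16 (d L : ℕ) (hd : 1 ≤ d) (hL : 1 ≤ L) (i₁ i₂ : Pt d)
    (hΛ : 8 * L ≤ ninf i₁ i₂) :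
    (ball i₁ (ninf i₁ i₂ - 3 * L) ∩ ball i₂ (ninf i₁ i₂ - 3 * L) ∩
      sbox {i₁, i₂}).Nonempty ∧
    ((ball i₁ (ninf i₁ i₂ - 3 * L) ∩ ball i₂ (ninf i₁ i₂ - 3 * L) ∩
      sbox {i₁, i₂}) ∩ ball i₁ (6 * L)).Nonempty ∧
    ((ball i₁ (ninf i₁ i₂ - 3 * L) ∩ ball i₂ (ninf i₁ i₂ - 3 * L) ∩
      sbox {i₁, i₂}) ∩ ball i₂ (6 * L)).Nonempty := by
  obtain ⟨z, hz, hz₁, hz₂⟩ := exists_mem_sbox_pair_near i₁ i₂ (3 * L)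
  obtain ⟨w, hw, hw₂, hw₁⟩ := exists_mem_sbox_pair_near i₂ i₁ (3 * L)
  rw [Set.pair_comm] at hw
  rw [ninf_comm i₂ i₁] at hw₁
  have hz_mem : z ∈ ball i₁ (ninf i₁ i₂ - 3 * L) ∩ ball i₂ (ninf i₁ i₂ - 3 * L) ∩
      sbox {i₁, i₂} := ⟨⟨hz₁.trans (by omega), hz₂⟩, hz⟩
  have hw_mem : w ∈ ball i₁ (ninf i₁ i₂ - 3 * L) ∩ ball i₂ (ninf i₁ i₂ - 3 * L) ∩
      sbox {i₁, i₂} := ⟨⟨hw₁, hw₂.trans (by omega)⟩, hw⟩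
  exact ⟨⟨z, hz_mem⟩, ⟨z, hz_mem, hz₁.trans (by omega)⟩, ⟨w, hw_mem, hw₂.trans (by omega)⟩⟩

end RI
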